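/- Let b̃ be a repulsive hyperbolic solution of x' = −x² + q(t)x + p(t) with dichotomy constant pair (k_b, β_b). Then: (1) for every s ∈ ℝ and every x₀ ≤ b̃(s), the solution x(t,s,x₀) is defined for all t ≤ s and satisfies |b̃(t) − x(t,s,x₀)| ≤ k_b e^{β_b(t−s)} |b̃(s) − x₀| for all t ≤ s; (2) for every β̄ ∈ (0, β_b) there exists ρ > 0 such that, for every s ∈ ℝ and every x₀ ∈ [b̃(s), b̃(s) + ρ], the solution x(t,s,x₀) is defined for all t ≤ s and satisfies |b̃(t) − x(t,s,x₀)| ≤ k_b e^{β̄(t−s)} |b̃(s) − x₀| for all t ≤ s. -/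

import Mathlib

open Set Filter

/-- The right-hand side of the quadratic equation `x' = -x² + Q(t)x + P(t)`. -/
def quadF (Q P : ℝ → ℝ) : ℝ → ℝ → ℝ := fun t x => -x ^ 2 + Q t * x + P t

/-- `b` is a globally defined bounded solution of `x' = -x² + Q(t)x + P(t)`. -/
def IsBddSol (Q P b : ℝ → ℝ) : Prop :=
  (∀ t, HasDerivAt b (quadF Q P t (b t)) t) ∧ ∃ C, ∀ t, |b t| ≤ C

/-- `(k, β)` is a dichotomy constant pair witnessing that the variational equation
`z' = (-2 b(t) + Q(t)) z` is Hurwitz at `+∞` (attractive case). -/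
def AttrDich (Q b : ℝ → ℝ) (k β : ℝ) : Prop :=
  1 ≤ k ∧ 0 < β ∧ ∀ s t : ℝ, s ≤ t →
    Real.exp (∫ l in s..t, (-2 * b l + Q l)) ≤ k * Real.exp (-β * (t - s))

/-- `(k, β)` is a dichotomy constant pair witnessing that the variational equation
`z' = (-2 b(t) + Q(t)) z` is Hurwitz at `−∞` (repulsive case). -/
def RepDich (Q b : ℝ → ℝ) (k β : ℝ) : Prop :=
  1 ≤ k ∧ 0 < β ∧ ∀ s t : ℝ, t ≤ s →
    Real.exp (∫ l in s..t, (-2 * b l + Q l)) ≤ k * Real.exp (β * (t - s))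

/-- `b` is an attractive hyperbolic solution of `x' = -x² + Q(t)x + P(t)`. -/
def IsAttrHyp (Q P b : ℝ → ℝ) : Prop := IsBddSol Q P b ∧ ∃ k β : ℝ, AttrDich Q b k β

/-- `b` is a repulsive hyperbolic solution of `x' = -x² + Q(t)x + P(t)`. -/
def IsRepHyp (Q P b : ℝ → ℝ) : Prop := IsBddSol Q P b ∧ ∃ k β : ℝ, RepDich Q b k β

/-- `b` is a hyperbolic solution of `x' = -x² + Q(t)x + P(t)`. -/
def IsHyp (Q P b : ℝ → ℝ) : Prop := IsAttrHyp Q P b ∨ IsRepHyp Q P b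

/-- The supremum norm distance between `f` and `g` is `< δ`. -/
def SupLt (f g : ℝ → ℝ) (δ : ℝ) : Prop := ∃ d : ℝ, d < δ ∧ ∀ t, |f t - g t| ≤ d

/-- The family of maximal solutions `t ↦ X t s x₀` of the scalar ODE `x' = h (t, x)`. -/
structure MaxSolFamily (h : ℝ → ℝ → ℝ) where
  X : ℝ → ℝ → ℝ → ℝ
  dom : ℝ → ℝ → Set ℝ
  dom_open : ∀ s x₀, IsOpen (dom s x₀)
  dom_ordConn : ∀ s x₀, (dom s x₀).OrdConnected
  mem_dom : ∀ s x₀, s ∈ dom s x₀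
  init : ∀ s x₀, X s s x₀ = x₀
  sol : ∀ s x₀, ∀ t ∈ dom s x₀, HasDerivAt (fun τ => X τ s x₀) (h t (X t s x₀)) t
  maximal : ∀ s x₀ (y : ℝ → ℝ) (I : Set ℝ), IsOpen I → I.OrdConnected → s ∈ I →
      y s = x₀ → (∀ t ∈ I, HasDerivAt y (h t (y t)) t) →
      I ⊆ dom s x₀ ∧ ∀ t ∈ I, y t = X t s x₀

/-- The solution `X · s x₀` is (defined and) bounded as `t → −∞`. -/
def BddAtBot {h : ℝ → ℝ → ℝ} (F : MaxSolFamily h) (s x₀ : ℝ) : Prop :=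
  ∃ C : ℝ, ∀ᶠ t in atBot, t ∈ F.dom s x₀ ∧ |F.X t s x₀| ≤ C

/-- The solution `X · s x₀` is (defined and) bounded as `t → ∞`. -/
def BddAtTop {h : ℝ → ℝ → ℝ} (F : MaxSolFamily h) (s x₀ : ℝ) : Prop :=
  ∃ C : ℝ, ∀ᶠ t in atTop, t ∈ F.dom s x₀ ∧ |F.X t s x₀| ≤ C

/-- `a` is the globally defined bounded solution characterized by:
`X · s x₀` is bounded as `t → −∞` iff `x₀ ≤ a s`. -/
def CharA {h : ℝ → ℝ → ℝ} (F : MaxSolFamily h) (a : ℝ → ℝ) : Prop :=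
  (∀ t, HasDerivAt a (h t (a t)) t) ∧ (∃ C, ∀ t, |a t| ≤ C) ∧
  ∀ s x₀ : ℝ, BddAtBot F s x₀ ↔ x₀ ≤ a s

/-- `r` is the globally defined bounded solution characterized by:
`X · s x₀` is bounded as `t → ∞` iff `x₀ ≥ r s`. -/
def CharR {h : ℝ → ℝ → ℝ} (F : MaxSolFamily h) (r : ℝ → ℝ) : Prop :=
  (∀ t, HasDerivAt r (h t (r t)) t) ∧ (∃ C, ∀ t, |r t| ≤ C) ∧
  ∀ s x₀ : ℝ, BddAtTop F s x₀ ↔ r s ≤ x₀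

/-- The fundamental solution, equal to `1` at `s`, of the linear equation `z' = a(t) z`. -/
noncomputable def linSol (a : ℝ → ℝ) (s t : ℝ) : ℝ := Real.exp (∫ l in s..t, a l)

lemma linSol_self (a : ℝ → ℝ) (s : ℝ) : linSol a s s = 1 := by simp [linSol]

lemma linSol_pos (a : ℝ → ℝ) (s t : ℝ) : 0 < linSol a s t := Real.exp_pos _

lemma hasDerivAt_linSol {a : ℝ → ℝ} (ha : Continuous a) (s t : ℝ) :
    HasDerivAt (linSol a s) (linSol a s t * a t) t :=
  (intervalIntegral.integral_hasDerivAt_right (ha.intervalIntegrable s t)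
    (ha.stronglyMeasurableAtFilter _ _) ha.continuousAt).exp

lemma continuous_linSol {a : ℝ → ℝ} (ha : Continuous a) (s : ℝ) : Continuous (linSol a s) :=
  continuous_iff_continuousAt.2 fun t => (hasDerivAt_linSol ha s t).continuousAt

lemma hasDerivAt_integral_linSol {a : ℝ → ℝ} (ha : Continuous a) (s t : ℝ) :
    HasDerivAt (fun t => ∫ l in s..t, linSol a s l) (linSol a s t) t :=
  intervalIntegral.integral_hasDerivAt_right ((continuous_linSol ha s).intervalIntegrable s t)
    ((continuous_linSol ha s).stronglyMeasurableAtFilter _ _) (continuous_linSol ha s).continuousAt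

lemma strictMono_integral_linSol {a : ℝ → ℝ} (ha : Continuous a) (s : ℝ) :
    StrictMono (fun t => ∫ l in s..t, linSol a s l) :=
  strictMono_of_hasDerivAt_pos (hasDerivAt_integral_linSol ha s) fun t => linSol_pos a s t

/-- Solutions of a Riccati equation are given explicitly by means of a known global solution `b`
and of the fundamental solution of the variational equation along `b`. -/
lemma mem_dom_and_X_eq {q p b : ℝ → ℝ} (hq : Continuous q) (F : MaxSolFamily (quadF q p))
    (hb : ∀ t, HasDerivAt b (quadF q p t (b t)) t) (s x₀ t : ℝ)
    (hD : 0 < 1 + (x₀ - b s) * ∫ l in s..t, linSol (fun l => -2 * b l + q l) s l) :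
    t ∈ F.dom s x₀ ∧
      F.X t s x₀ = b t + (x₀ - b s) * linSol (fun l => -2 * b l + q l) s t /
        (1 + (x₀ - b s) * ∫ l in s..t, linSol (fun l => -2 * b l + q l) s l) := by
  have hbc : Continuous b := continuous_iff_continuousAt.2 fun t => (hb t).continuousAt
  have ha : Continuous (fun l => -2 * b l + q l) := by fun_prop
  set a : ℝ → ℝ := fun l => -2 * b l + q l with ha_def
  set c := x₀ - b s with hc
  set D : ℝ → ℝ := fun t => 1 + c * ∫ l in s..t, linSol a s l with hDdef
  have hD' : ∀ t, HasDerivAt D (c * linSol a s t) t := fun t =>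
    ((hasDerivAt_integral_linSol ha s t).const_mul c).const_add 1
  have hDc : Continuous D := continuous_iff_continuousAt.2 fun t => (hD' t).continuousAt
  have hmono := (strictMono_integral_linSol ha s).monotone
  have hord : ({t | 0 < D t} : Set ℝ).OrdConnected := by
    refine ⟨fun x hx y hy z hz => ?_⟩
    rcases le_total 0 c with h0 | h0
    · exact lt_of_lt_of_le hx
        (add_le_add_right (mul_le_mul_of_nonneg_left (hmono hz.1) h0) 1)
    · exact lt_of_lt_of_le hy
        (add_le_add_right (mul_le_mul_of_nonpos_left (hmono hz.2) h0) 1)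
  have key := F.maximal s x₀ (fun t => b t + c * linSol a s t / D t) {t | 0 < D t}
    (isOpen_lt continuous_const hDc) hord (by simp [hDdef])
    (by simp [hDdef, linSol_self, hc]) (fun t ht => by
      have hne : D t ≠ 0 := ne_of_gt ht
      refine ((hb t).add (((hasDerivAt_linSol ha s t).const_mul c).div (hD' t) hne)).congr_deriv ?_
      simp only [quadF, ha_def]
      field_simp
      ring)
  exact ⟨key.1 hD, (key.2 t hD).symm⟩

lemma integral_linSol_nonpos {a : ℝ → ℝ} (ha : Continuous a) {s t : ℝ} (h : t ≤ s) :
    ∫ l in s..t, linSol a s l ≤ 0 := by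
  simpa using (strictMono_integral_linSol ha s).monotone h

lemma le_integral_linSol {a : ℝ → ℝ} (ha : Continuous a) {k β s : ℝ} (hβ : 0 < β)
    (h : ∀ t ≤ s, linSol a s t ≤ k * Real.exp (β * (t - s))) {t : ℝ} (hts : t ≤ s) :
    k / β * (Real.exp (β * (t - s)) - 1) ≤ ∫ l in s..t, linSol a s l := by
  set g : ℝ → ℝ := fun t => (∫ l in s..t, linSol a s l) - k / β * Real.exp (β * (t - s))
  have hg : ∀ t, HasDerivAt g (linSol a s t - k * Real.exp (β * (t - s))) t := fun t => by
    have h1 : HasDerivAt (fun t : ℝ => β * (t - s)) β t := by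
      simpa using ((hasDerivAt_id t).sub_const s).const_mul β
    refine ((hasDerivAt_integral_linSol ha s t).sub (h1.exp.const_mul (k / β))).congr_deriv ?_
    field_simp
  have hanti : AntitoneOn g (Iic s) := by
    refine antitoneOn_of_deriv_nonpos (convex_Iic s)
      (fun t _ => (hg t).continuousAt.continuousWithinAt)
      (fun t _ => (hg t).differentiableAt.differentiableWithinAt) fun t ht => ?_
    rw [(hg t).deriv]
    exact sub_nonpos.2 (h t (interior_subset ht : t ∈ Iic s))
  have := hanti hts self_mem_Iic hts
  simp only [g, intervalIntegral.integral_same, sub_self, mul_zero, Real.exp_zero] at this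
  linarith

/-- Bernoulli's inequality in exponential form. -/
lemma exp_le_one_add_mul_exp_sub_one {β δ τ : ℝ} (hβ : 0 < β) (hδ : 0 ≤ δ) (hδβ : δ ≤ β) :
    Real.exp (δ * τ) ≤ 1 + δ / β * (Real.exp (β * τ) - 1) := by
  have := rpow_one_add_le_one_add_mul_self (s := Real.exp (β * τ) - 1) (p := δ / β)
    (by linarith [Real.exp_pos (β * τ)]) (by positivity) ((div_le_one hβ).2 hδβ)
  rw [add_sub_cancel, ← Real.exp_mul] at this
  convert this using 2
  field_simp

theorem stmt7 (q p : ℝ → ℝ)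
    (hqb : ∃ C, ∀ t, |q t| ≤ C) (hqu : UniformContinuous q)
    (hpb : ∃ C, ∀ t, |p t| ≤ C) (hpu : UniformContinuous p)
    (F : MaxSolFamily (quadF q p))
    (b : ℝ → ℝ) (kb βb : ℝ)
    (hb : IsBddSol q p b) (hdich : RepDich q b kb βb) :
    -- (1)
    (∀ s x₀ : ℝ, x₀ ≤ b s →
      (∀ t, t ≤ s → t ∈ F.dom s x₀) ∧
      (∀ t, t ≤ s → |b t - F.X t s x₀| ≤ kb * Real.exp (βb * (t - s)) * |b s - x₀|)) ∧
    -- (2)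
    (∀ β' : ℝ, 0 < β' → β' < βb → ∃ ρ > (0:ℝ), ∀ s x₀ : ℝ,
      b s ≤ x₀ → x₀ ≤ b s + ρ →
      (∀ t, t ≤ s → t ∈ F.dom s x₀) ∧
      (∀ t, t ≤ s → |b t - F.X t s x₀| ≤ kb * Real.exp (β' * (t - s)) * |b s - x₀|)) := by
  have hq := hqu.continuous
  have hbc : Continuous b := continuous_iff_continuousAt.2 fun t => (hb.1 t).continuousAt
  have ha : Continuous (fun l => -2 * b l + q l) := by fun_prop
  obtain ⟨hk, hβ, hdich⟩ := hdich
  have hU : ∀ s t, t ≤ s →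
      linSol (fun l => -2 * b l + q l) s t ≤ kb * Real.exp (βb * (t - s)) := hdich
  have hk0 : 0 < kb := by linarith
  refine ⟨fun s x₀ hx => ?_, fun β' hβ' hlt => ?_⟩
  · have hD : ∀ t, t ≤ s →
        1 ≤ 1 + (x₀ - b s) * ∫ l in s..t, linSol (fun l => -2 * b l + q l) s l := fun t ht =>
      le_add_of_nonneg_right
        (mul_nonneg_of_nonpos_of_nonpos (sub_nonpos.2 hx) (integral_linSol_nonpos ha ht))
    have hX := fun t ht => mem_dom_and_X_eq hq F hb.1 s x₀ t (one_pos.trans_le (hD t ht))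
    refine ⟨fun t ht => (hX t ht).1, fun t ht => ?_⟩
    have hU0 := linSol_pos (fun l => -2 * b l + q l) s t
    rw [(hX t ht).2, sub_add_cancel_left, abs_neg, abs_div, abs_mul, abs_of_pos hU0,
      abs_of_pos (one_pos.trans_le (hD t ht)), abs_sub_comm (b s)]
    refine (div_le_self (by positivity) (hD t ht)).trans ?_
    rw [mul_comm]
    exact mul_le_mul_of_nonneg_right (hU s t ht) (abs_nonneg _)
  · refine ⟨(βb - β') / kb, div_pos (sub_pos.2 hlt) hk0, fun s x₀ hx hx' => ?_⟩
    have hD : ∀ t, t ≤ s → Real.exp ((βb - β') * (t - s)) ≤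
        1 + (x₀ - b s) * ∫ l in s..t, linSol (fun l => -2 * b l + q l) s l := fun t ht => by
      refine (exp_le_one_add_mul_exp_sub_one hβ (sub_pos.2 hlt).le (by linarith)).trans ?_
      have h1 := le_integral_linSol ha hβ (hU s) ht
      have h2 := integral_linSol_nonpos ha ht
      have h3 : (βb - β') / kb * (kb / βb * (Real.exp (βb * (t - s)) - 1)) =
          (βb - β') / βb * (Real.exp (βb * (t - s)) - 1) := by field_simp
      rw [← h3]
      refine add_le_add_right ((mul_le_mul_of_nonneg_left h1
        (div_pos (sub_pos.2 hlt) hk0).le).trans ?_) 1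
      exact mul_le_mul_of_nonpos_right (by linarith) h2
    have hX := fun t ht => mem_dom_and_X_eq hq F hb.1 s x₀ t ((Real.exp_pos _).trans_le (hD t ht))
    refine ⟨fun t ht => (hX t ht).1, fun t ht => ?_⟩
    have hU0 := linSol_pos (fun l => -2 * b l + q l) s t
    have hD0 := (Real.exp_pos _).trans_le (hD t ht)
    rw [(hX t ht).2, sub_add_cancel_left, abs_neg, abs_div, abs_mul, abs_of_pos hU0,
      abs_of_pos hD0, abs_sub_comm (b s), div_le_iff₀ hD0]
    have hexp : Real.exp (βb * (t - s)) =
        Real.exp (β' * (t - s)) * Real.exp ((βb - β') * (t - s)) := by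
      rw [← Real.exp_add]; ring_nf
    calc |x₀ - b s| * linSol (fun l => -2 * b l + q l) s t
        ≤ |x₀ - b s| * (kb * Real.exp (βb * (t - s))) := by gcongr; exact hU s t ht
      _ = kb * Real.exp (β' * (t - s)) * |x₀ - b s| * Real.exp ((βb - β') * (t - s)) := by
        rw [hexp]; ring
      _ ≤ _ := by gcongr; exact hD t ht
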